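/- Let C be a q-ary Singleton-optimal [n,k,d;r]-locally repairable code with locality r = 1, minimum distance d = 5 and dimension k > 1. Then n < 9. -/

import Mathlib

open Finset

section Defs

variable {F : Type*} [Field F] [Fintype F] [DecidableEq F]

/-- The minimum (Hamming) distance of the linear code `C` is exactly `d`. -/
def MinDistIs {n : ℕ} (C : Submodule F (Fin n → F)) (d : ℕ) : Prop :=
  (∃ c ∈ C, c ≠ 0 ∧ hammingNorm c = d) ∧ ∀ c ∈ C, c ≠ 0 → d ≤ hammingNorm c

/-- `R` is a recovery set at coordinate `i` for the code `C`: any two codewords that agree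
on all coordinates of `R` other than `i` also agree at `i`. -/
def IsRecoverySet {n : ℕ} (C : Submodule F (Fin n → F)) (i : Fin n)
    (R : Finset (Fin n)) : Prop :=
  i ∈ R ∧ ∀ u ∈ C, ∀ v ∈ C, (∀ j ∈ R, j ≠ i → u j = v j) → u i = v i

/-- The code `C` has locality `r`: every coordinate has a recovery set of size at most `r+1`. -/
def HasLocality {n : ℕ} (C : Submodule F (Fin n → F)) (r : ℕ) : Prop :=
  ∀ i : Fin n, ∃ R : Finset (Fin n), R.card ≤ r + 1 ∧ IsRecoverySet C i R

/-- The parameters attain the Singleton-type bound for LRCs: `d = n - k - ⌈k/r⌉ + 2`. -/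
def SingletonOptimalParams (n k d r : ℕ) : Prop :=
  (d : ℤ) = (n : ℤ) - (k : ℤ) - ⌈(k : ℚ) / (r : ℚ)⌉ + 2

/-- `C` is a Singleton-optimal `[n,k,d;r]`-locally repairable code over `F`. -/
def IsOptLRC {n : ℕ} (C : Submodule F (Fin n → F)) (k d r : ℕ) : Prop :=
  Module.finrank F ↥C = k ∧ MinDistIs C d ∧ HasLocality C r ∧ SingletonOptimalParams n k d r

/-- `x` belongs to the dual code of `C` (w.r.t. the standard bilinear form). -/
def InDual {n : ℕ} (C : Submodule F (Fin n → F)) (x : Fin n → F) : Prop :=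
  ∀ c ∈ C, ∑ i, x i * c i = 0

/-- `P` is a partition of the coordinates `{1,…,n}` into supports of dual codewords of
Hamming weight at most `r+1` (disjoint recovery sets). -/
def IsRecoveryPartition {n : ℕ} (C : Submodule F (Fin n → F)) (r : ℕ)
    (P : Finset (Finset (Fin n))) : Prop :=
  (∀ S ∈ P, ∃ c : Fin n → F, InDual C c ∧ c ≠ 0 ∧ hammingNorm c ≤ r + 1 ∧
      (Finset.univ.filter fun i => c i ≠ 0) = S) ∧
  (∀ S ∈ P, ∀ T ∈ P, S ≠ T → Disjoint S T) ∧
  (∀ i : Fin n, ∃ S ∈ P, i ∈ S)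

/-- `C` has disjoint recovery sets. -/
def HasDisjointRecoverySets {n : ℕ} (C : Submodule F (Fin n → F)) (r : ℕ) : Prop :=
  ∃ P : Finset (Finset (Fin n)), IsRecoveryPartition C r P

/-- The Main MDS Conjecture over `F`: every nontrivial MDS code over `F`
(dimension `κ` with `2 ≤ κ ≤ m - 2`, minimum distance `δ = m - κ + 1`) has
length `m` at most `q + 2`, where `q = |F|`. -/
def MDSConjecture (F : Type*) [Field F] [Fintype F] [DecidableEq F] : Prop :=
  ∀ (m κ δ : ℕ) (D : Submodule F (Fin m → F)),
    Module.finrank F ↥D = κ → MinDistIs D δ → δ + κ = m + 1 →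
    2 ≤ κ → κ + 2 ≤ m → m ≤ Fintype.card F + 2

end Defs

lemma kill_step {F : Type*} [Field F] {n : ℕ} (D : Submodule F (Fin n → F)) (j : Fin n) :
    ∃ D' : Submodule F (Fin n → F), D' ≤ D ∧ (∀ c ∈ D', c j = 0) ∧
      Module.finrank F D ≤ Module.finrank F D' + 1 := by
  let φ : D →ₗ[F] F := (LinearMap.proj j).comp D.subtype
  refine ⟨(LinearMap.ker φ).map D.subtype, ?_, ?_, ?_⟩
  · rintro c ⟨x, _, rfl⟩
    exact x.2
  · rintro c ⟨x, hx, rfl⟩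
    exact hx
  · have h1 := LinearMap.finrank_range_add_finrank_ker φ
    have h2 : Module.finrank F (LinearMap.range φ) ≤ 1 := by
      simpa using Submodule.finrank_le (LinearMap.range φ)
    have h3 : Module.finrank F ((LinearMap.ker φ).map D.subtype)
        = Module.finrank F (LinearMap.ker φ) :=
      (Submodule.equivMapOfInjective _ D.subtype_injective _).finrank_eq.symm
    omega

theorem optLRC_d5_r1 {F : Type*} [Field F] [Fintype F] [DecidableEq F]
    {n k : ℕ} (C : Submodule F (Fin n → F))
    (hC : IsOptLRC C k 5 1) (hk : 1 < k) :
    n < 9 := by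
  classical
  exfalso
  obtain ⟨hdim, ⟨-, hmin⟩, hloc, hopt⟩ := hC
  have hn : n = 2 * k + 3 := by
    unfold SingletonOptimalParams at hopt
    simp at hopt
    omega
  have hp : ∀ i : Fin n, (∀ c ∈ C, c i = 0) ∨ ∃ j, j ≠ i ∧ ∀ c ∈ C, c j = 0 → c i = 0 := by
    intro i
    obtain ⟨R, hR, hi, hrec⟩ := hloc i
    have hc : (R.erase i).card ≤ 1 := by
      rw [Finset.card_erase_of_mem hi]; omega
    by_cases he : ∃ j, j ∈ R.erase i
    · obtain ⟨j, hj⟩ := he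
      right
      refine ⟨j, (Finset.mem_erase.1 hj).1, fun c hc' h0 => ?_⟩
      refine hrec c hc' 0 C.zero_mem fun l hl hli => ?_
      have : l = j := Finset.card_le_one.1 hc l (Finset.mem_erase.2 ⟨hli, hl⟩) j hj
      subst this
      simpa using h0
    · left
      intro c hc'
      refine hrec c hc' 0 C.zero_mem fun l hl hli => ?_
      exact absurd ⟨l, Finset.mem_erase.2 ⟨hli, hl⟩⟩ he
  -- base
  have base : ∃ m, m + 1 ≤ k ∧ ∃ D : Submodule F (Fin n → F), D ≤ C ∧
      k ≤ Module.finrank F D + m ∧ ∃ Z : Finset (Fin n), 2 * m + 1 ≤ Z.card ∧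
        ∀ i ∈ Z, ∀ c ∈ D, c i = 0 := by
    by_cases hz : ∃ i, ∀ c ∈ C, c i = 0
    · obtain ⟨i, hi⟩ := hz
      refine ⟨0, by omega, C, le_rfl, by omega, {i}, by simp, ?_⟩
      simpa using hi
    · have hp' : ∀ i : Fin n, ∃ j, j ≠ i ∧ ∀ c ∈ C, c j = 0 → c i = 0 := fun i =>
        (hp i).resolve_left fun h => hz ⟨i, h⟩
      choose f hf1 hf2 using hp'
      by_cases hinv : ∀ i, f (f i) = i
      · exfalso
        have := Finset.sum_involution (s := (Finset.univ : Finset (Fin n)))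
          (f := fun _ => (1 : ZMod 2)) (fun i _ => f i) (fun _ _ => by decide)
          (fun i _ _ => hf1 i) (fun _ _ => Finset.mem_univ _) (fun i _ => hinv i)
        simp at this
        rw [ZMod.natCast_eq_zero_iff] at this
        omega
      · push Not at hinv
        obtain ⟨i, hi⟩ := hinv
        obtain ⟨D, hDC, hD0, hDr⟩ := kill_step C (f (f i))
        refine ⟨1, by omega, D, hDC, by omega, {i, f i, f (f i)}, ?_, ?_⟩
        · rw [Finset.card_eq_three.2 ⟨i, f i, f (f i), (hf1 i).symm, hi.symm, (hf1 (f i)).symm, rfl⟩]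
        · intro l hl c hc
          have h1 := hD0 c hc
          have h2 := hf2 _ c (hDC hc) h1
          have h3 := hf2 _ c (hDC hc) h2
          simp only [Finset.mem_insert, Finset.mem_singleton] at hl
          rcases hl with rfl | rfl | rfl <;> assumption
  obtain ⟨m₀, hm₀, hbase⟩ := base
  have key : ∀ m, m₀ ≤ m → m + 1 ≤ k → ∃ D : Submodule F (Fin n → F), D ≤ C ∧
      k ≤ Module.finrank F D + m ∧ ∃ Z : Finset (Fin n), 2 * m + 1 ≤ Z.card ∧
        ∀ i ∈ Z, ∀ c ∈ D, c i = 0 := by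
    intro m hm
    induction m, hm using Nat.le_induction with
    | base => exact fun _ => hbase
    | succ m hm ih =>
      intro hmk
      obtain ⟨D, hDC, hDr, Z, hZ, hZ0⟩ := ih (by omega)
      by_cases hall : ∀ i, ∀ c ∈ D, c i = 0
      · exfalso
        have : D = ⊥ := by
          rw [Submodule.eq_bot_iff]
          exact fun c hc => funext fun i => hall i c hc
        subst this
        simp at hDr
        omega
      · push Not at hall
        obtain ⟨i, c, hc, hci⟩ := hall
        rcases hp i with h | ⟨j, hji, hj⟩
        · exact absurd (h c (hDC hc)) hci
        have hiZ : i ∉ Z := fun h => hci (hZ0 i h c hc)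
        have hjZ : j ∉ Z := fun h => hci (hj c (hDC hc) (hZ0 j h c hc))
        obtain ⟨D', hD'D, hD'0, hD'r⟩ := kill_step D j
        refine ⟨D', hD'D.trans hDC, by omega, insert i (insert j Z), ?_, ?_⟩
        · rw [Finset.card_insert_of_notMem, Finset.card_insert_of_notMem hjZ]
          · omega
          · simp [hiZ, hji.symm]
        · intro l hl x hx
          have h1 := hD'0 x hx
          have h2 := hj x (hDC (hD'D hx)) h1
          simp only [Finset.mem_insert] at hl
          rcases hl with rfl | rfl | hl
          · exact h2
          · exact h1
          · exact hZ0 l hl x (hD'D hx)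
  obtain ⟨D, hDC, hDr, Z, hZ, hZ0⟩ := key (k - 1) (by omega) (by omega)
  have hne : D ≠ ⊥ := by
    rintro rfl
    simp at hDr
    omega
  obtain ⟨c, hc, hc0⟩ := Submodule.exists_mem_ne_zero_of_ne_bot hne
  have h5 := hmin c (hDC hc) hc0
  have hle : hammingNorm c ≤ (Zᶜ).card := by
    unfold hammingNorm
    apply Finset.card_le_card
    intro i hi
    simp only [Finset.mem_filter, Finset.mem_univ, true_and] at hi
    simp only [Finset.mem_compl]
    exact fun h => hi (hZ0 i h c hc)
  rw [Finset.card_compl, Fintype.card_fin] at hle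
  omega
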